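/- arXiv:2505.07366 — 3 statements merged into one kernel-verified Lean document; each statement's English description precedes it below -/
import Mathlib

section
/- Let U ⊆ ℝ³ be open and let φ : ℝ³ → ℝ be of class C² on U with |∇φ(x)| = 1 for every x ∈ U. Set n := −∇φ and τ¹ := (0, −∂₃φ, ∂₂φ), τ² := (∂₃φ, 0, −∂₁φ), τ³ := (−∂₂φ, ∂₁φ, 0), and for a differentiable function g define Zᵢg := τⁱ·∇g and ∂ₙg := n·∇g. Then for every function f : ℝ³ → ℝ of class C² on U and every x ∈ U, Δf(x) = Z₁(Z₁f)(x) + Z₂(Z₂f)(x) + Z₃(Z₃f)(x) + ∂ₙ(∂ₙf)(x) − Δφ(x) · (∂ₙf)(x), where Δ denotes the Euclidean Laplacian. -/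
open scoped BigOperators

/-- Partial derivative `∂ᵢ g (x)` of a scalar function on `ℝ³`. -/
noncomputable def pd (g : (Fin 3 → ℝ) → ℝ) (x : Fin 3 → ℝ) (i : Fin 3) : ℝ :=
  fderiv ℝ g x (Pi.single i 1)

/-- The Euclidean Laplacian `Δg(x) = ∑ᵢ ∂ᵢ∂ᵢ g(x)`. -/
noncomputable def lap (g : (Fin 3 → ℝ) → ℝ) (x : Fin 3 → ℝ) : ℝ :=
  ∑ i, pd (fun y => pd g y i) x i

/-- Directional derivative of `g` along the vector field `w`: `(w·∇)g`. -/
noncomputable def dirD (w : (Fin 3 → ℝ) → Fin 3 → ℝ) (g : (Fin 3 → ℝ) → ℝ) :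
    (Fin 3 → ℝ) → ℝ :=
  fun x => ∑ i, w x i * pd g x i

/-- The tangential field `τ¹ := (0, -∂₃φ, ∂₂φ)`. -/
noncomputable def tau1 (φ : (Fin 3 → ℝ) → ℝ) (x : Fin 3 → ℝ) : Fin 3 → ℝ :=
  ![0, -pd φ x 2, pd φ x 1]

/-- The tangential field `τ² := (∂₃φ, 0, -∂₁φ)`. -/
noncomputable def tau2 (φ : (Fin 3 → ℝ) → ℝ) (x : Fin 3 → ℝ) : Fin 3 → ℝ :=
  ![pd φ x 2, 0, -pd φ x 0]

/-- The tangential field `τ³ := (-∂₂φ, ∂₁φ, 0)`. -/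
noncomputable def tau3 (φ : (Fin 3 → ℝ) → ℝ) (x : Fin 3 → ℝ) : Fin 3 → ℝ :=
  ![-pd φ x 1, pd φ x 0, 0]

/-- The (extended inward) normal field `n := -∇φ`. -/
noncomputable def nvec (φ : (Fin 3 → ℝ) → ℝ) (x : Fin 3 → ℝ) : Fin 3 → ℝ :=
  fun i => -(pd φ x i)

theorem pd_neg (g : (Fin 3 → ℝ) → ℝ) (x : Fin 3 → ℝ) (j : Fin 3) :
    pd (fun y => -g y) x j = -pd g x j := by
  simp [pd, fderiv_fun_neg]

theorem pd_zero (x : Fin 3 → ℝ) (j : Fin 3) : pd (fun _ => 0) x j = 0 := by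
  simp [pd]

/-- First partial derivatives of a function that is `C²` near `x` are differentiable at `x`. -/
theorem differentiableAt_pd {g : (Fin 3 → ℝ) → ℝ} {x : Fin 3 → ℝ}
    (hg : ContDiffAt ℝ 2 g x) (i : Fin 3) : DifferentiableAt ℝ (fun y => pd g y i) x :=
  ((hg.fderiv_right (m := 1) (by norm_num)).differentiableAt one_ne_zero).clm_apply
    (differentiableAt_const _)

/-- Second partial derivatives commute. -/
theorem pd_pd_comm {g : (Fin 3 → ℝ) → ℝ} {x : Fin 3 → ℝ}
    (hg : ContDiffAt ℝ 2 g x) (i j : Fin 3) :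
    pd (fun y => pd g y i) x j = pd (fun y => pd g y j) x i := by
  have hd : DifferentiableAt ℝ (fderiv ℝ g) x :=
    (hg.fderiv_right (m := 1) (by norm_num)).differentiableAt one_ne_zero
  have key (a b : Fin 3) : pd (fun y => pd g y a) x b =
      fderiv ℝ (fderiv ℝ g) x (Pi.single b 1) (Pi.single a 1) := by
    simp only [pd]
    rw [fderiv_clm_apply hd (differentiableAt_const _)]
    simp
  rw [key, key]
  exact (hg.isSymmSndFDerivAt (by simp)).eq _ _

/-- Leibniz rule for the composition of two directional derivatives. -/
theorem dirD_dirD (w v : (Fin 3 → ℝ) → Fin 3 → ℝ) {f : (Fin 3 → ℝ) → ℝ} {x : Fin 3 → ℝ}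
    (hv : ∀ i, DifferentiableAt ℝ (fun y => v y i) x) (hf : ContDiffAt ℝ 2 f x) :
    dirD w (dirD v f) x = ∑ j, w x j * ∑ i,
      (v x i * pd (fun y => pd f y i) x j + pd f x i * pd (fun y => v y i) x j) := by
  refine Finset.sum_congr rfl fun j _ => ?_
  congr 1
  have h := HasFDerivAt.fun_sum (u := Finset.univ) fun (i : Fin 3) _ =>
    (hv i).hasFDerivAt.mul (differentiableAt_pd hf i).hasFDerivAt
  have h' : HasFDerivAt (dirD v f) _ x := h
  rw [pd, h'.fderiv]
  simp [pd]

/-- If `|∇φ| = 1` near `x`, the Hessian of `φ` at `x` annihilates `∇φ`. -/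
theorem sum_pd_mul_pd_pd_eq_zero {φ : (Fin 3 → ℝ) → ℝ} {x : Fin 3 → ℝ}
    (hφ : ContDiffAt ℝ 2 φ x) (hunit : ∀ᶠ y in nhds x, ∑ i, (pd φ y i) ^ 2 = 1) (j : Fin 3) :
    ∑ i, pd φ x i * pd (fun y => pd φ y i) x j = 0 := by
  have h := HasFDerivAt.fun_sum (u := Finset.univ) fun (i : Fin 3) _ =>
    (differentiableAt_pd hφ i).hasFDerivAt.pow 2
  have h0 : HasFDerivAt (fun y => ∑ i, (pd φ y i) ^ 2) 0 x :=
    (hasFDerivAt_const (𝕜 := ℝ) (1 : ℝ) x).congr_of_eventuallyEq hunit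
  have h1 := congrArg (fun L => L (Pi.single j 1)) (h.unique h0)
  simp only [Fin.sum_univ_three, pd] at h1 ⊢
  simp at h1
  linarith

/-- Proposition 4.2, Laplacian identity: if `φ` is `C²` on the open set `U` with
`|∇φ| = 1` on `U`, then for every `f` of class `C²` on `U` and every `x ∈ U`,
`Δf = Z₁²f + Z₂²f + Z₃²f + ∂ₙ²f − (Δφ)·∂ₙf`, where `Zᵢ g := τⁱ·∇g` and `∂ₙ g := n·∇g`. -/
theorem laplacian_tangential_normal
    (U : Set (Fin 3 → ℝ)) (hU : IsOpen U)
    (φ : (Fin 3 → ℝ) → ℝ) (hφ : ContDiffOn ℝ 2 φ U)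
    (hunit : ∀ x ∈ U, ∑ i, (pd φ x i) ^ 2 = 1)
    (f : (Fin 3 → ℝ) → ℝ) (hf : ContDiffOn ℝ 2 f U) :
    ∀ x ∈ U,
      lap f x
        = dirD (tau1 φ) (dirD (tau1 φ) f) x
          + dirD (tau2 φ) (dirD (tau2 φ) f) x
          + dirD (tau3 φ) (dirD (tau3 φ) f) x
          + dirD (nvec φ) (dirD (nvec φ) f) x
          - lap φ x * dirD (nvec φ) f x := by
  intro x hx
  have hUx := hU.mem_nhds hx
  have hφx := hφ.contDiffAt hUx
  have hfx := hf.contDiffAt hUx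
  have hp := differentiableAt_pd hφx
  have hH := sum_pd_mul_pd_pd_eq_zero hφx (Filter.eventually_of_mem hUx hunit)
  have h0 := hH 0
  have h1 := hH 1
  have h2 := hH 2
  have hS := hunit x hx
  have ht1 : ∀ i, DifferentiableAt ℝ (fun y => tau1 φ y i) x := by
    intro i; fin_cases i <;> simp [tau1, hp]
  have ht2 : ∀ i, DifferentiableAt ℝ (fun y => tau2 φ y i) x := by
    intro i; fin_cases i <;> simp [tau2, hp]
  have ht3 : ∀ i, DifferentiableAt ℝ (fun y => tau3 φ y i) x := by
    intro i; fin_cases i <;> simp [tau3, hp]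
  have hn : ∀ i, DifferentiableAt ℝ (fun y => nvec φ y i) x := fun i => (hp i).neg
  rw [dirD_dirD _ _ ht1 hfx, dirD_dirD _ _ ht2 hfx, dirD_dirD _ _ ht3 hfx,
    dirD_dirD _ _ hn hfx]
  simp only [Fin.sum_univ_three, lap, dirD, tau1, tau2, tau3, nvec, Matrix.cons_val,
    pd_neg, pd_zero] at h0 h1 h2 hS ⊢
  simp only [pd_pd_comm hφx 1 0, pd_pd_comm hφx 2 0, pd_pd_comm hφx 2 1] at h0 h1 ⊢
  rw [pd_pd_comm hfx 1 0, pd_pd_comm hfx 2 0, pd_pd_comm hfx 2 1]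
  linear_combination
    -(pd (fun y => pd f y 0) x 0 + pd (fun y => pd f y 1) x 1 + pd (fun y => pd f y 2) x 2) * hS
    - 2 * pd f x 0 * h0 - 2 * pd f x 1 * h1 - 2 * pd f x 2 * h2
end

section
/- Let x ∈ ℝ³ and let φ : ℝ³ → ℝ be differentiable at x with |∇φ(x)| = 1. Set n := −∇φ(x) and τ¹ := (0, −∂₃φ(x), ∂₂φ(x)), τ² := (∂₃φ(x), 0, −∂₁φ(x)), τ³ := (−∂₂φ(x), ∂₁φ(x), 0). Then for every vector field f : ℝ³ → ℝ³ that is differentiable at x, div f(x) = (Z₁f)(x)·τ¹ + (Z₂f)(x)·τ² + (Z₃f)(x)·τ³ + (∂ₙf)(x)·n, where Zᵢf and ∂ₙf denote the componentwise directional derivatives of f along τⁱ and n respectively. -/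
open scoped BigOperators

/-- Euclidean dot product on `ℝ³`. -/
def dot (a b : Fin 3 → ℝ) : ℝ := ∑ i, a i * b i

/-- Componentwise directional derivative of a vector field `f` along the vector `w` at
the point `x`. -/
noncomputable def vecD (w : Fin 3 → ℝ) (f : (Fin 3 → ℝ) → (Fin 3 → ℝ)) (x : Fin 3 → ℝ) :
    Fin 3 → ℝ :=
  fun j => ∑ i, w i * pd (fun y => f y j) x i

/-- Proposition 4.2, divergence identity: if `φ` is differentiable at `x` with
`|∇φ(x)| = 1`, then for every vector field `f` differentiable at `x`,
`div f(x) = (Z₁f)·τ¹ + (Z₂f)·τ² + (Z₃f)·τ³ + (∂ₙf)·n`, where `Zᵢf` and `∂ₙf` are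
componentwise directional derivatives along `τⁱ` and `n := -∇φ(x)`. -/
theorem divergence_tangential_normal
    (x : Fin 3 → ℝ) (φ : (Fin 3 → ℝ) → ℝ)
    (hφ : DifferentiableAt ℝ φ x)
    (hunit : ∑ i, (pd φ x i) ^ 2 = 1)
    (f : (Fin 3 → ℝ) → (Fin 3 → ℝ))
    (hf : DifferentiableAt ℝ f x) :
    (∑ i, pd (fun y => f y i) x i)
      = dot (vecD (tau1 φ x) f x) (tau1 φ x)
        + dot (vecD (tau2 φ x) f x) (tau2 φ x)
        + dot (vecD (tau3 φ x) f x) (tau3 φ x)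
        + dot (vecD (nvec φ x) f x) (nvec φ x) := by
  simp only [Fin.sum_univ_three] at hunit
  simp only [dot, vecD, tau1, tau2, tau3, nvec, Fin.sum_univ_three, Matrix.cons_val]
  linear_combination (-(pd (fun y => f y 0) x 0 + pd (fun y => f y 1) x 1
    + pd (fun y => f y 2) x 2)) * hunit
end

section
/- Let γ > 1, T > 0 and C₀ > 0. Then there exist ε₀ > 0 and C* > 0, depending only on γ, T and C₀, with the following property: for every ε ∈ (0, ε₀], every T′ ∈ (0, T/ε], every continuous function K : [0,T′] → [0,∞) with ∫₀^{T′} K(s) ds ≤ 1, and every differentiable function W : [0,T′] → [0,∞) satisfying W(0) ≤ C₀ ε^{1/2} and W′(t) ≤ C₀ W(t) ( ε + (1 + t²)^{−γ/2} + ε^{3/2} W(t) + K(t) ) for all t ∈ [0,T′], one has W(t) ≤ C* ε^{1/2} for all t ∈ [0,T′]. -/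
/-- A Riccati-type Grönwall bound: if `W' ≤ a W + c W²` on `[0, L]`, the primitive of `a` is
at most `M`, and `4 c e^M w L < 1` with `W 0 ≤ w`, then `W ≤ 2 w e^M` on `[0, L]`. -/
theorem le_of_deriv_le_mul_add_mul_sq {a W W' : ℝ → ℝ} {c M w L : ℝ}
    (ha : Continuous a) (hc : 0 ≤ c) (hw : 0 < w) (hL : 0 < L)
    (hAM : ∀ t ∈ Set.Icc 0 L, ∫ s in (0 : ℝ)..t, a s ≤ M)
    (hsmall : 4 * c * Real.exp M * w * L < 1)
    (hW : ∀ t ∈ Set.Icc 0 L, 0 ≤ W t)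
    (hd : ∀ t ∈ Set.Icc 0 L, HasDerivWithinAt W (W' t) (Set.Icc 0 L) t)
    (hW0 : W 0 ≤ w)
    (hle : ∀ t ∈ Set.Icc 0 L, W' t ≤ a t * W t + c * W t ^ 2) :
    ∀ t ∈ Set.Icc 0 L, W t ≤ 2 * w * Real.exp M := by
  set A : ℝ → ℝ := fun t => ∫ s in (0 : ℝ)..t, a s with hA
  have hAd (t : ℝ) : HasDerivAt A (a t) t := ha.integral_hasStrictDerivAt 0 t |>.hasDerivAt
  have hEd (t : ℝ) : HasDerivAt (fun t => Real.exp (-A t)) (Real.exp (-A t) * -a t) t :=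
    (hAd t).neg.exp
  have hyd (t : ℝ) (ht : t ∈ Set.Icc 0 L) :=
    (hd t ht).mul (hEd t).hasDerivWithinAt
  have hBle (t : ℝ) (ht : t ∈ Set.Icc 0 L) : w * (1 + t / L) ≤ 2 * w := by
    have : t / L ≤ 1 := (div_le_one hL).2 ht.2
    nlinarith
  have key : ∀ ⦃t⦄, t ∈ Set.Icc 0 L → W t * Real.exp (-A t) ≤ w * (1 + t / L) := by
    refine image_le_of_deriv_right_lt_deriv_boundary (B' := fun _ => w * (1 / L))
      (fun t ht => (hyd t ht).continuousWithinAt)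
      (fun t ht => (hyd t (Set.Ico_subset_Icc_self ht)).mono_of_mem_nhdsWithin
        (Icc_mem_nhdsGE_of_mem ht)) ?_
      (fun t => (((hasDerivAt_id t).div_const L).const_add 1).const_mul w) ?_
    · simpa [hA] using hW0
    · intro t ht hyB
      have ht' := Set.Ico_subset_Icc_self ht
      simp only [Pi.mul_apply] at hyB
      have hE := Real.exp_pos (-A t)
      have hWy : W t = W t * Real.exp (-A t) * Real.exp (A t) := by
        rw [mul_assoc, ← Real.exp_add]; simp
      have hy0 : 0 ≤ W t * Real.exp (-A t) := mul_nonneg (hW t ht') hE.le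
      calc W' t * Real.exp (-A t) + W t * (Real.exp (-A t) * -a t)
          ≤ (a t * W t + c * W t ^ 2) * Real.exp (-A t)
              + W t * (Real.exp (-A t) * -a t) := by
            gcongr
            exact hle t ht'
        _ = c * Real.exp (A t) * (W t * Real.exp (-A t)) ^ 2 := by
            linear_combination c * W t * Real.exp (-A t) * hWy
        _ ≤ c * Real.exp M * (2 * w) ^ 2 := by
            have := hAM t ht'
            have := hyB.trans_le (hBle t ht')
            gcongr
        _ < w * (1 / L) := by
            rw [mul_one_div, lt_div_iff₀ hL]
            nlinarith
  intro t ht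
  have h1 := (key ht).trans (hBle t ht)
  calc W t = W t * Real.exp (-A t) * Real.exp (A t) := by
        rw [mul_assoc, ← Real.exp_add]; simp
    _ ≤ 2 * w * Real.exp M := by
        have := hAM t ht
        gcongr

theorem continuous_one_add_sq_rpow (r : ℝ) : Continuous fun t : ℝ => (1 + t ^ 2) ^ r :=
  (by fun_prop : Continuous fun t : ℝ => 1 + t ^ 2).rpow_const fun t => .inl (by positivity)

theorem integral_one_add_sq_rpow_le {γ t : ℝ} (hγ : 1 < γ) (ht : 0 ≤ t) :
    ∫ s in (0 : ℝ)..t, (1 + s ^ 2) ^ (-(γ / 2)) ≤ ∫ s : ℝ, (1 + s ^ 2) ^ (-(γ / 2)) := by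
  have hint : MeasureTheory.Integrable fun s : ℝ => (1 + s ^ 2) ^ (-(γ / 2)) := by
    simpa [neg_div] using integrable_rpow_neg_one_add_norm_sq (E := ℝ)
      (μ := MeasureTheory.volume) (r := γ) (by simpa using hγ)
  rw [intervalIntegral.integral_of_le ht]
  exact MeasureTheory.setIntegral_le_integral hint (.of_forall fun s => by positivity)


/-- The differential-inequality core of the continuity (bootstrap) argument in the proof
of Proposition 4.11: for `γ > 1`, `T > 0`, `C₀ > 0` there are `ε₀, C* > 0` (depending
only on `γ, T, C₀`) such that for every `ε ∈ (0, ε₀]`, every `T' ∈ (0, T/ε]`, every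
continuous nonnegative `K` on `[0,T']` with `∫₀^{T'} K ≤ 1`, and every differentiable
nonnegative `W` with `W(0) ≤ C₀ √ε` and
`W' ≤ C₀ W (ε + ⟨t⟩^{-γ} + ε^{3/2} W + K)` on `[0,T']`, one has `W ≤ C* √ε` on `[0,T']`. -/
theorem bootstrap_differential_inequality
    (γ T C₀ : ℝ) (hγ : 1 < γ) (hT : 0 < T) (hC₀ : 0 < C₀) :
    ∃ ε₀ > (0 : ℝ), ∃ Cstar > (0 : ℝ),
      ∀ ε : ℝ, 0 < ε → ε ≤ ε₀ →
      ∀ T' : ℝ, 0 < T' → T' ≤ T / ε →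
      ∀ K : ℝ → ℝ, ContinuousOn K (Set.Icc 0 T') →
        (∀ s ∈ Set.Icc (0 : ℝ) T', 0 ≤ K s) →
        (∫ s in (0 : ℝ)..T', K s) ≤ 1 →
      ∀ W W' : ℝ → ℝ,
        (∀ t ∈ Set.Icc (0 : ℝ) T', 0 ≤ W t) →
        (∀ t ∈ Set.Icc (0 : ℝ) T', HasDerivWithinAt W (W' t) (Set.Icc 0 T') t) →
        W 0 ≤ C₀ * Real.sqrt ε →
        (∀ t ∈ Set.Icc (0 : ℝ) T',
          W' t ≤ C₀ * W t * (ε + (1 + t ^ 2) ^ (-(γ / 2)) + ε ^ ((3 : ℝ) / 2) * W t + K t)) →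
        ∀ t ∈ Set.Icc (0 : ℝ) T', W t ≤ Cstar * Real.sqrt ε := by
  set J : ℝ := ∫ s : ℝ, (1 + s ^ 2) ^ (-(γ / 2))
  set M : ℝ := C₀ * (T + J + 1)
  refine ⟨1 / (8 * C₀ ^ 2 * Real.exp M * T), by positivity, 2 * C₀ * Real.exp M, by positivity, ?_⟩
  intro ε hε hεle T' hT' hT'le K hK hK0 hK1 W W' hW hd hW0 hle t ht
  rw [le_div_iff₀ (by positivity)] at hεle
  rw [le_div_iff₀ hε] at hT'le
  set k : ℝ → ℝ := Set.IccExtend hT'.le (Set.domRestrict (Set.Icc 0 T') K)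
  have hkc : Continuous k := hK.domRestrict.Icc_extend'
  have hkK (s : ℝ) (hs : s ∈ Set.Icc 0 T') : k s = K s := Set.IccExtend_of_mem _ _ hs
  have hk0 (s : ℝ) : 0 ≤ k s := hK0 _ (Set.projIcc 0 T' hT'.le s).2
  have hg := continuous_one_add_sq_rpow (-(γ / 2))
  have hkint : ∫ s in (0 : ℝ)..T', k s ≤ 1 := by
    rwa [intervalIntegral.integral_congr (g := K)
      (fun s hs => hkK s (by rwa [Set.uIcc_of_le hT'.le] at hs))]
  have hsqrt : ε ^ ((3 : ℝ) / 2) * Real.sqrt ε = ε ^ 2 := by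
    rw [Real.sqrt_eq_rpow, ← Real.rpow_add hε]
    norm_num
  have := le_of_deriv_le_mul_add_mul_sq (a := fun s => C₀ * (ε + (1 + s ^ 2) ^ (-(γ / 2)) + k s))
    (W := W) (W' := W') (c := C₀ * ε ^ ((3 : ℝ) / 2)) (M := M) (w := C₀ * Real.sqrt ε) (L := T')
    (by fun_prop) (by positivity) (by positivity) hT' ?_ ?_ hW hd hW0 ?_ t ht
  · linarith
  · intro s hs
    have h1 := integral_one_add_sq_rpow_le hγ hs.1
    have h2 : ∫ u in (0 : ℝ)..s, k u ≤ ∫ u in (0 : ℝ)..T', k u :=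
      intervalIntegral.integral_mono_interval le_rfl hs.1 hs.2 (.of_forall hk0)
        (hkc.intervalIntegrable _ _)
    have h3 : ε * s ≤ T := by nlinarith [hs.2]
    have hεg : Continuous fun u : ℝ => ε + (1 + u ^ 2) ^ (-(γ / 2)) := continuous_const.add hg
    rw [intervalIntegral.integral_const_mul, intervalIntegral.integral_add
      (hεg.intervalIntegrable _ _) (hkc.intervalIntegrable _ _),
      intervalIntegral.integral_add (continuous_const.intervalIntegrable _ _)
      (hg.intervalIntegrable _ _), intervalIntegral.integral_const, smul_eq_mul]
    refine mul_le_mul_of_nonneg_left ?_ hC₀.le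
    linarith
  · calc 4 * (C₀ * ε ^ ((3 : ℝ) / 2)) * Real.exp M * (C₀ * Real.sqrt ε) * T'
        = 4 * C₀ ^ 2 * Real.exp M * ε * (T' * ε) := by
          linear_combination 4 * C₀ ^ 2 * Real.exp M * T' * hsqrt
      _ ≤ 4 * C₀ ^ 2 * Real.exp M * ε * T := by gcongr
      _ < 1 := by linarith
  · intro s hs
    have := hle s hs
    rw [← hkK s hs] at this
    linarith
end
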